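/- For every radial F̄ ∈ C_c^∞(ℝ³) and every δ > 0 there exists a compactly supported, C², radial function G : ℝ³ → ℝ which is constant on some ball B_r about the origin (r > 0) and satisfies ‖G − F̄‖_{H²(ℝ³)} < δ. (That is, compactly supported radial functions that are constant near the origin are H²-dense among radial test functions.) -/

import Mathlib

open MeasureTheory Filter Set
open scoped Topology

noncomputable section

abbrev E3 : Type := EuclideanSpace ℝ (Fin 3)

/-- `i`-th partial derivative of `F` at `x`. -/
def pd (F : E3 → ℝ) (x : E3) (i : Fin 3) : ℝ :=
  fderiv ℝ F x (EuclideanSpace.single i 1)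

/-- Second partial derivative `∂_i ∂_j F` at `x`. -/
def pd2 (F : E3 → ℝ) (x : E3) (i j : Fin 3) : ℝ :=
  fderiv ℝ (fun y => pd F y j) x (EuclideanSpace.single i 1)

/-- Square of the `H²(ℝ³)` norm of `F`. -/
def H2sq (F : E3 → ℝ) : ℝ :=
  ∫ x : E3, ((F x) ^ 2 + ‖gradient F x‖ ^ 2 + ∑ i : Fin 3, ∑ j : Fin 3, (pd2 F x i j) ^ 2)

/-- The entries of the Hessian are bounded by the norm of the second derivative. -/
lemma abs_pd2_le {F : E3 → ℝ} (hF : ContDiff ℝ 2 F) (x : E3) (i j : Fin 3) :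
    |pd2 F x i j| ≤ ‖iteratedFDeriv ℝ 2 F x‖ := by
  have hd : DifferentiableAt ℝ (fderiv ℝ F) x :=
    (hF.fderiv_right (m := 1) (by norm_num)).differentiable (by norm_num) x
  have h : pd2 F x i j = iteratedFDeriv ℝ 2 F x
      ![EuclideanSpace.single i 1, EuclideanSpace.single j 1] := by
    rw [iteratedFDeriv_two_apply]
    simp [pd2, pd, fderiv_clm_apply hd (differentiableAt_const _)]
  rw [h, ← Real.norm_eq_abs]
  refine (ContinuousMultilinearMap.le_opNorm _ _).trans ?_
  simp [Fin.prod_univ_two]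

/-- The `H²` norm of a function supported in a ball, in terms of sup bounds on its derivatives. -/
lemma H2sq_le_of_tsupport_subset {F : E3 → ℝ} (hF : ContDiff ℝ 2 F) {R K : ℝ}
    (hsupp : tsupport F ⊆ Metric.closedBall 0 R)
    (hK : ∀ k ≤ 2, ∀ x ∈ Metric.closedBall (0 : E3) R, ‖iteratedFDeriv ℝ k F x‖ ≤ K) :
    H2sq F ≤ 11 * K ^ 2 * volume.real (Metric.closedBall (0 : E3) R) := by
  have hgrad : ∀ x, ‖gradient F x‖ = ‖iteratedFDeriv ℝ 1 F x‖ := fun x => by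
    rw [norm_iteratedFDeriv_one, gradient, LinearIsometryEquiv.norm_map]
  have hzero : ∀ (k : ℕ), ∀ x ∉ Metric.closedBall (0 : E3) R, ‖iteratedFDeriv ℝ k F x‖ = 0 := by
    intro k x hx
    rw [norm_eq_zero]
    by_contra h
    exact hx (hsupp (support_iteratedFDeriv_subset k h))
  have hpt : ∀ (c : ℝ) (x : E3), (∀ k ≤ 2, ‖iteratedFDeriv ℝ k F x‖ ≤ c) →
      ‖(F x) ^ 2 + ‖gradient F x‖ ^ 2 + ∑ i : Fin 3, ∑ j : Fin 3, (pd2 F x i j) ^ 2‖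
        ≤ 11 * c ^ 2 := by
    intro c x hc
    have h0 : (F x) ^ 2 ≤ c ^ 2 := by
      have := hc 0 (by norm_num)
      rw [norm_iteratedFDeriv_zero, Real.norm_eq_abs] at this
      rw [← sq_abs]
      gcongr
    have h1 : ‖gradient F x‖ ^ 2 ≤ c ^ 2 := by
      have := hc 1 (by norm_num)
      rw [← hgrad] at this
      gcongr
    have h2 : ∑ i : Fin 3, ∑ j : Fin 3, (pd2 F x i j) ^ 2 ≤ ∑ _i : Fin 3, ∑ _j : Fin 3, c ^ 2 := by
      refine Finset.sum_le_sum fun i _ => Finset.sum_le_sum fun j _ => ?_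
      have := (abs_pd2_le hF x i j).trans (hc 2 le_rfl)
      rw [← sq_abs]
      gcongr
    simp only [Finset.sum_const, Finset.card_univ, Fintype.card_fin, nsmul_eq_mul] at h2
    rw [Real.norm_of_nonneg (by positivity)]
    push_cast at h2
    linarith
  rw [H2sq, ← setIntegral_eq_integral_of_forall_compl_eq_zero
    (s := Metric.closedBall (0 : E3) R)]
  · exact (le_abs_self _).trans (norm_setIntegral_le_of_norm_le_const measure_closedBall_lt_top
      fun x hx => hpt K x fun k hk => hK k hk x hx)
  · intro x hx
    have := hpt 0 x fun k _ => (hzero k x hx).le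
    simpa using this

/-- Taylor bounds at the origin for an even function with bounded second derivative. -/
lemma norm_iteratedFDeriv_const_sub_le_of_even {E : Type*} [NormedAddCommGroup E]
    [NormedSpace ℝ E] {F : E → ℝ} (hF : ContDiff ℝ 2 F) (heven : ∀ x, F (-x) = F x) {M : ℝ}
    (hM : ∀ x, ‖iteratedFDeriv ℝ 2 F x‖ ≤ M) {k : ℕ} (hk : k ≤ 2) (x : E) :
    ‖iteratedFDeriv ℝ k (fun y => F 0 - F y) x‖ ≤ M * ‖x‖ ^ (2 - k) := by
  have hdF : Differentiable ℝ F := hF.differentiable (by norm_num)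
  have hddF : Differentiable ℝ (fderiv ℝ F) :=
    (hF.fderiv_right (m := 1) (by norm_num)).differentiable (by norm_num)
  have hM' : ∀ y, ‖fderiv ℝ (fderiv ℝ F) y‖ ≤ M := fun y => by
    have := hM y
    rwa [← norm_iteratedFDeriv_fderiv, norm_iteratedFDeriv_one] at this
  have hcrit : fderiv ℝ F 0 = 0 := by
    have h0 : HasFDerivAt F (fderiv ℝ F 0) (-(0 : E)) := by simpa using (hdF 0).hasFDerivAt
    have h : HasFDerivAt F (-fderiv ℝ F 0) 0 := by
      simpa [Function.comp_def, heven] using h0.comp (0 : E) (hasFDerivAt_id (0 : E)).neg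
    ext v
    have hv : fderiv ℝ F 0 v = -fderiv ℝ F 0 v := congrArg (· v) h.fderiv
    simpa using self_eq_neg.mp hv
  have hfd : ∀ y, ‖fderiv ℝ F y‖ ≤ M * ‖y‖ := fun y => by
    simpa [hcrit] using convex_univ.norm_image_sub_le_of_norm_fderiv_le (𝕜 := ℝ)
      (fun z _ => hddF z) (fun z _ => hM' z) (mem_univ (0 : E)) (mem_univ y)
  have hM0 : 0 ≤ M := (norm_nonneg _).trans (hM 0)
  have hpos : ∀ n : ℕ, n ≠ 0 → ‖iteratedFDeriv ℝ n (fun y => F 0 - F y) x‖ =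
      ‖iteratedFDeriv ℝ n F x‖ := fun n hn => by
    obtain ⟨m, rfl⟩ := Nat.exists_eq_succ_of_ne_zero hn
    rw [← norm_iteratedFDeriv_fderiv, ← norm_iteratedFDeriv_fderiv]
    have : fderiv ℝ (fun y => F 0 - F y) = -fderiv ℝ F := by
      ext1 y
      simp [fderiv_const_sub]
    rw [this, iteratedFDeriv_neg, Pi.neg_apply, norm_neg]
  interval_cases k
  · have hx : ‖F x - F 0‖ ≤ M * ‖x‖ * ‖x - 0‖ :=
      (convex_closedBall (0 : E) ‖x‖).norm_image_sub_le_of_norm_fderiv_le (𝕜 := ℝ)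
        (fun z _ => hdF z)
        (fun z hz => (hfd z).trans (by
          have : ‖z‖ ≤ ‖x‖ := by simpa using hz
          gcongr))
        (by simp) (by simp)
    rw [norm_iteratedFDeriv_zero, norm_sub_rev]
    simpa [pow_two, mul_assoc] using hx
  · rw [hpos 1 (by norm_num), norm_iteratedFDeriv_one]
    simpa using hfd x
  · rw [hpos 2 (by norm_num)]
    simpa using hM x

/-- Rescaling a cut-off by `ε` and multiplying by a function vanishing to second order at the
origin keeps the derivatives up to order two bounded uniformly in `ε`. -/
lemma norm_iteratedFDeriv_rescale_mul_le {E : Type*} [NormedAddCommGroup E] [NormedSpace ℝ E]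
    {χ H : E → ℝ} (hχ : ContDiff ℝ 2 χ) (hH : ContDiff ℝ 2 H) {C M : ℝ}
    (hC : ∀ k ≤ 2, ∀ x, ‖iteratedFDeriv ℝ k χ x‖ ≤ C)
    (hM : ∀ k ≤ 2, ∀ x, ‖iteratedFDeriv ℝ k H x‖ ≤ M * ‖x‖ ^ (2 - k)) (hM0 : 0 ≤ M)
    {ε : ℝ} (hε : 0 < ε) (hε1 : ε ≤ 1) {x : E} (hx : ‖x‖ ≤ 2 * ε) {k : ℕ} (hk : k ≤ 2) :
    ‖iteratedFDeriv ℝ k (fun y => χ (ε⁻¹ • y) * H y) x‖ ≤ 16 * (C * M) := by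
  have hC0 : 0 ≤ C := (norm_nonneg _).trans (hC 0 (by norm_num) 0)
  have hχε : ContDiff ℝ 2 fun y : E => χ (ε⁻¹ • y) := hχ.comp (contDiff_const_smul _)
  refine (norm_iteratedFDeriv_mul_le hχε hH x (n := k) (by exact_mod_cast hk)).trans ?_
  have hterm : ∀ i ∈ Finset.range (k + 1),
      (k.choose i : ℝ) * ‖iteratedFDeriv ℝ i (fun y => χ (ε⁻¹ • y)) x‖ *
        ‖iteratedFDeriv ℝ (k - i) H x‖ ≤ (k.choose i : ℝ) * (4 * (C * M)) := by
    intro i hi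
    have hik : i ≤ k := Nat.lt_succ_iff.mp (Finset.mem_range.mp hi)
    have h1 : ‖iteratedFDeriv ℝ i (fun y => χ (ε⁻¹ • y)) x‖ ≤ ε⁻¹ ^ i * C := by
      rw [iteratedFDeriv_comp_const_smul _ (hχ.of_le (by exact_mod_cast hik.trans hk)),
        norm_smul, norm_pow, Real.norm_of_nonneg (by positivity)]
      gcongr
      exact hC i (hik.trans hk) _
    have h2 : ‖iteratedFDeriv ℝ (k - i) H x‖ ≤ M * (2 * ε) ^ (2 - k + i) := by
      refine (hM (k - i) (by omega) x).trans ?_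
      rw [show 2 - (k - i) = 2 - k + i by omega]
      gcongr
    rw [mul_assoc]
    refine mul_le_mul_of_nonneg_left ?_ (Nat.cast_nonneg _)
    calc _ ≤ (ε⁻¹ ^ i * C) * (M * (2 * ε) ^ (2 - k + i)) := by gcongr
      _ = 2 ^ (2 - k + i) * ε ^ (2 - k) * (C * M) := by
        rw [mul_pow, pow_add ε, inv_pow]
        field_simp
      _ ≤ 2 ^ 2 * 1 * (C * M) := by
        gcongr
        · norm_num
        · omega
        · exact pow_le_one₀ hε.le hε1
      _ = 4 * (C * M) := by ring
  refine (Finset.sum_le_sum hterm).trans ?_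
  rw [← Finset.sum_mul, ← Nat.cast_sum, Nat.sum_range_choose]
  have : ((2 ^ k : ℕ) : ℝ) ≤ 4 := by
    interval_cases k <;> norm_num
  nlinarith [mul_nonneg hC0 hM0]

/-- A smooth radial cut-off, equal to `1` on the unit ball and supported in the ball of
radius `2`. -/
def radialCutoff (x : E3) : ℝ := Real.smoothTransition (2 - ‖x‖ ^ 2)

lemma contDiff_radialCutoff : ContDiff ℝ 2 radialCutoff :=
  Real.smoothTransition.contDiff.comp (contDiff_const.sub (contDiff_norm_sq ℝ))

lemma radialCutoff_eq_one {x : E3} (hx : ‖x‖ ≤ 1) : radialCutoff x = 1 :=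
  Real.smoothTransition.one_of_one_le (by nlinarith [norm_nonneg x])

lemma radialCutoff_eq_zero {x : E3} (hx : 2 ≤ ‖x‖) : radialCutoff x = 0 :=
  Real.smoothTransition.zero_of_nonpos (by nlinarith)

lemma hasCompactSupport_radialCutoff : HasCompactSupport radialCutoff :=
  HasCompactSupport.intro (isCompact_closedBall (0 : E3) 2) fun x hx =>
    radialCutoff_eq_zero (by simpa using (not_le.mp (by simpa using hx)).le)

/-- The derivatives of order at most two of a compactly supported `C²` function are bounded. -/
lemma exists_bound_iteratedFDeriv {E : Type*} [NormedAddCommGroup E] [NormedSpace ℝ E]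
    {F : E → ℝ} (hF : ContDiff ℝ 2 F) (hsupp : HasCompactSupport F) :
    ∃ C, ∀ k ≤ 2, ∀ x, ‖iteratedFDeriv ℝ k F x‖ ≤ C := by
  have h : ∀ k : Fin 3, ∃ C, ∀ x, ‖iteratedFDeriv ℝ k F x‖ ≤ C := fun k =>
    (hsupp.iteratedFDeriv k).exists_bound_of_continuous
      (hF.continuous_iteratedFDeriv (by exact_mod_cast Nat.lt_succ_iff.mp k.2))
  choose C hC using h
  refine ⟨∑ i, |C i|, fun k hk x => (hC ⟨k, by omega⟩ x).trans ((le_abs_self _).trans ?_)⟩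
  exact Finset.single_le_sum (f := fun i => |C i|) (fun i _ => abs_nonneg _) (Finset.mem_univ _)

/-- Compactly supported, `C²`, radial functions that are constant on a ball about the
origin are `H²(ℝ³)`-dense among radial test functions: for every radial
`F̄ ∈ C_c^∞(ℝ³)` and every `δ > 0` there exists such a `G` with `‖G − F̄‖_{H²(ℝ³)} < δ`. -/
theorem constant_near_origin_H2_dense
    (Fb : E3 → ℝ) (fb : ℝ → ℝ)
    (hF : ContDiff ℝ (⊤ : ℕ∞) Fb) (hsupp : HasCompactSupport Fb)
    (hrad : ∀ x : E3, Fb x = fb ‖x‖) :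
    ∀ δ > 0, ∃ (G : E3 → ℝ) (g : ℝ → ℝ),
      HasCompactSupport G ∧ ContDiff ℝ 2 G ∧ (∀ x : E3, G x = g ‖x‖) ∧
      (∃ r > 0, ∃ a : ℝ, ∀ x ∈ Metric.ball (0:E3) r, G x = a) ∧
      Real.sqrt (H2sq (fun x : E3 => G x - Fb x)) < δ := by
  intro δ hδ
  have hF2 : ContDiff ℝ 2 Fb := contDiff_infty.mp hF 2
  obtain ⟨C, hC⟩ := exists_bound_iteratedFDeriv contDiff_radialCutoff
    hasCompactSupport_radialCutoff
  obtain ⟨M, hM⟩ := exists_bound_iteratedFDeriv hF2 hsupp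
  have hM0 : 0 ≤ M := (norm_nonneg _).trans (hM 0 (by norm_num) 0)
  have hH2 : ContDiff ℝ 2 fun x => Fb 0 - Fb x := contDiff_const.sub hF2
  have hHM : ∀ k ≤ 2, ∀ x, ‖iteratedFDeriv ℝ k (fun y => Fb 0 - Fb y) x‖ ≤ M * ‖x‖ ^ (2 - k) :=
    fun k hk x => norm_iteratedFDeriv_const_sub_le_of_even hF2
      (fun y => by rw [hrad, hrad y, norm_neg]) (hM 2 le_rfl) hk x
  obtain ⟨ε, hε, hε1, hεδ⟩ : ∃ ε : ℝ, 0 < ε ∧ ε ≤ 1 ∧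
      11 * (16 * (C * M)) ^ 2 * ((2 * ε) ^ 3 * volume.real (Metric.ball (0 : E3) 1)) < δ ^ 2 := by
    have hlim : Tendsto (fun ε : ℝ => 11 * (16 * (C * M)) ^ 2 *
        ((2 * ε) ^ 3 * volume.real (Metric.ball (0 : E3) 1))) (𝓝[>] 0) (𝓝 0) :=
      tendsto_nhdsWithin_of_tendsto_nhds (Continuous.tendsto' (by fun_prop) _ _ (by simp))
    obtain ⟨ε, h, hε⟩ := ((hlim.eventually_lt_const (pow_pos hδ 2)).and
      (Ioc_mem_nhdsGT (zero_lt_one' ℝ))).exists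
    exact ⟨ε, hε.1, hε.2, h⟩
  have hnorm : ∀ x : E3, ‖ε⁻¹ • x‖ = ε⁻¹ * ‖x‖ := fun x => by
    rw [norm_smul, Real.norm_of_nonneg (inv_nonneg.mpr hε.le)]
  have hzero : ∀ x ∉ Metric.closedBall (0 : E3) (2 * ε),
      radialCutoff (ε⁻¹ • x) * (Fb 0 - Fb x) = 0 := fun x hx => by
    have hx' : 2 * ε < ‖x‖ := by simpa using hx
    rw [radialCutoff_eq_zero, zero_mul]
    rw [hnorm, ← div_eq_inv_mul, le_div_iff₀ hε]
    exact hx'.le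
  have hprod : ContDiff ℝ 2 fun x : E3 => radialCutoff (ε⁻¹ • x) * (Fb 0 - Fb x) :=
    (contDiff_radialCutoff.comp (contDiff_const_smul _)).mul hH2
  refine ⟨fun x => Fb x + radialCutoff (ε⁻¹ • x) * (Fb 0 - Fb x),
    fun s => fb s + Real.smoothTransition (2 - (ε⁻¹ * s) ^ 2) * (Fb 0 - fb s),
    hsupp.add (HasCompactSupport.intro (isCompact_closedBall _ _) hzero), hF2.add hprod,
    fun x => by simp only [radialCutoff, hnorm, hrad x], ⟨ε, hε, Fb 0, fun x hx => ?_⟩, ?_⟩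
  · have hx' : ‖x‖ < ε := by simpa using hx
    have h1 : radialCutoff (ε⁻¹ • x) = 1 := radialCutoff_eq_one (by
      rw [hnorm, ← div_eq_inv_mul, div_le_one hε]
      exact hx'.le)
    simp [h1]
  · simp only [add_sub_cancel_left]
    rw [Real.sqrt_lt' hδ]
    refine (H2sq_le_of_tsupport_subset hprod (R := 2 * ε) (K := 16 * (C * M)) ?_ ?_).trans_lt ?_
    · refine closure_minimal (fun x hx => ?_) Metric.isClosed_closedBall
      by_contra h
      exact hx (hzero x h)
    · intro k hk x hx
      exact norm_iteratedFDeriv_rescale_mul_le contDiff_radialCutoff hH2 hC hHM hM0 hε hε1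
        (by simpa using hx) hk
    · rw [Measure.addHaar_real_closedBall _ _ (by positivity)]
      simpa using hεδ
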